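/- For any containment-compatible processing order π of the family R, n·H(R) ≤ 3·A^π(R). -/

import Mathlib

open scoped Classical

/-- The open interval family member `i` is `Set.Ioo (l i) (r i)`.
The contact set of `R_i` under the (identity) processing order:
indices `j ≤ i` whose interval intersects `R_i`. -/
noncomputable def contact (n : ℕ) (l r : Fin n → ℝ) (i : Fin n) : Finset (Fin n) :=
  Finset.univ.filter
    (fun j : Fin n => j ≤ i ∧ (Set.Ioo (l j) (r j) ∩ Set.Ioo (l i) (r i)).Nonempty)

/-- The π-ambiguity of the family (already relabeled in processing order). -/
noncomputable def piAmbiguity (n : ℕ) (l r : Fin n → ℝ) : ℝ :=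
  ∑ i : Fin n, Real.logb 2 ((contact n l r i).card : ℝ)

/-- A processing order (given as the relabeled family) is containment-compatible if
whenever `R_i ⊂ R_j` (proper subset) then `i < j`. -/
def ContainmentCompatible (n : ℕ) (l r : Fin n → ℝ) : Prop :=
  ∀ i j : Fin n, Set.Ioo (l i) (r i) ⊂ Set.Ioo (l j) (r j) → i < j

/-- The ambiguity: the minimum of the π-ambiguity over all processing orders. -/
noncomputable def ambiguity (n : ℕ) (l r : Fin n → ℝ) : ℝ :=
  ⨅ π : Equiv.Perm (Fin n), piAmbiguity n (l ∘ π) (r ∘ π)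

/-- Combinatorial equivalence of two indexed families of nonempty bounded open
intervals: `R_i` lies entirely to the left of `R_j` iff `I_i` lies entirely to
the left of `I_j`. -/
def CombEquiv {ι : Type*} (l r l' r' : ι → ℝ) : Prop :=
  ∀ i j : ι, (r i ≤ l j ↔ r' i ≤ l' j)

/-- `intervalE l r lam = E(R, λ)`: the supremum of `∑ log₂ |I_i|` over families of
open subintervals of `(0, λ)` combinatorially equivalent to `R`. -/
noncomputable def intervalE {ι : Type*} [Fintype ι] (l r : ι → ℝ) (lam : ℝ) : ℝ :=
  sSup { x : ℝ | ∃ l' r' : ι → ℝ,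
    (∀ i, 0 ≤ l' i ∧ l' i < r' i ∧ r' i ≤ lam) ∧
    CombEquiv l r l' r' ∧ x = ∑ i, Real.logb 2 (r' i - l' i) }

/-- The interval entropy `H(R) = E(R, n)/n`. -/
noncomputable def intervalEntropy (n : ℕ) (l r : Fin n → ℝ) : ℝ :=
  intervalE l r (n : ℝ) / (n : ℝ)

/-- The number of linear extensions of the interval order induced by `R`
(`i ≺ j` iff `r i ≤ l j`), counted via ranking permutations. -/
noncomputable def numLinExt (n : ℕ) (l r : Fin n → ℝ) : ℕ :=
  Fintype.card {σ : Equiv.Perm (Fin n) // ∀ i j : Fin n, r i ≤ l j → σ i < σ j}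

/-- The weight given to an interval with `t` contacts; it vanishes for `t = 1`. -/
noncomputable def contactWeight (t : ℕ) : ℝ := 1 / (2 * t * (t - 1))

lemma contactWeight_nonneg (t : ℕ) : 0 ≤ contactWeight t := by
  unfold contactWeight
  rcases Nat.eq_zero_or_pos t with rfl | h
  · simp
  · have : (1 : ℝ) ≤ t := by exact_mod_cast h
    have : (0 : ℝ) ≤ t - 1 := by linarith
    positivity

lemma contactWeight_pos {t : ℕ} (ht : 2 ≤ t) : 0 < contactWeight t := by
  unfold contactWeight
  have : (2 : ℝ) ≤ t := by exact_mod_cast ht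
  have : (0 : ℝ) < t - 1 := by linarith
  positivity

lemma contactWeight_anti {s t : ℕ} (hs : 2 ≤ s) (hst : s ≤ t) :
    contactWeight t ≤ contactWeight s := by
  unfold contactWeight
  have h2 : (2 : ℝ) ≤ s := by exact_mod_cast hs
  have h3 : (s : ℝ) ≤ t := by exact_mod_cast hst
  have : (0 : ℝ) < s - 1 := by linarith
  apply one_div_le_one_div_of_le
  · positivity
  · gcongr

lemma sum_contactWeight_le {ι : Type*} [LinearOrder ι] (g : ι → ℕ) (Q : Finset ι)
    (h : ∀ q ∈ Q, (Q.filter (· ≤ q)).card + 1 ≤ g q) :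
    ∑ q ∈ Q, contactWeight (g q) ≤ 1 / 2 - 1 / (2 * ((Q.card : ℝ) + 1)) := by
  induction Q using Finset.induction_on_max with
  | empty => simp
  | insert a s ha ih =>
    have has : a ∉ s := fun h' => lt_irrefl _ (ha a h')
    rw [Finset.sum_insert has, Finset.card_insert_of_notMem has]
    have hs := ih fun q hq => by
      refine le_trans ?_ (h q (Finset.mem_insert_of_mem hq))
      gcongr
      exact Finset.subset_insert _ _
    have hfull : (insert a s).filter (· ≤ a) = insert a s := by
      refine Finset.filter_true_of_mem fun x hx => ?_
      rcases Finset.mem_insert.1 hx with rfl | hx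
      · exact le_rfl
      · exact (ha x hx).le
    have hga := h a (Finset.mem_insert_self _ _)
    rw [hfull, Finset.card_insert_of_notMem has] at hga
    have hw := contactWeight_anti (by omega) hga
    have hid : contactWeight (s.card + 1 + 1)
        = 1 / (2 * ((s.card : ℝ) + 1)) - 1 / (2 * (((s.card + 1 : ℕ) : ℝ) + 1)) := by
      unfold contactWeight
      push_cast
      field_simp
      ring
    linarith

lemma log_inv_contactWeight_le {t : ℕ} (ht : 2 ≤ t) :
    Real.log (contactWeight t)⁻¹ + 1 / t ≤ 3 * Real.log t := by
  have h2 : (2 : ℝ) ≤ t := by exact_mod_cast ht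
  have h1 : (0 : ℝ) < t - 1 := by linarith
  have h0 : (0 : ℝ) < t := by linarith
  have hsplit : (contactWeight t)⁻¹ = (2 * ((t : ℝ) - 1) / t ^ 2) * (t : ℝ) ^ 3 := by
    unfold contactWeight
    field_simp
  have hlog := Real.log_le_sub_one_of_pos (x := 2 * ((t : ℝ) - 1) / t ^ 2) (by positivity)
  have hpoly : 2 * ((t : ℝ) - 1) / t ^ 2 + 1 / t ≤ 1 := by
    rw [div_add_div _ _ (by positivity) (by positivity), div_le_one (by positivity)]
    nlinarith [mul_nonneg h0.le (mul_nonneg h1.le (sub_nonneg.2 h2))]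
  rw [hsplit, Real.log_mul (by positivity) (by positivity), Real.log_pow]
  push_cast
  linarith

lemma log_inv_one_sub_le {c : ℝ} (h0 : 0 ≤ c) (h1 : c ≤ 1 / 2) :
    Real.log (1 - c)⁻¹ ≤ 2 * c := by
  have hpos : 0 < 1 - c := by linarith
  refine (Real.log_le_sub_one_of_pos (inv_pos.2 hpos)).trans ?_
  rw [sub_le_iff_le_add, inv_le_iff_one_le_mul₀ hpos]
  nlinarith

/-- Weighted AM-GM for intervals: if the weights of the intervals over any point sum to at most
one, the product of the lengths is at most the product of the inverse weights. -/
lemma sum_log_length_le (n : ℕ) (l r w : Fin n → ℝ)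
    (hI : ∀ i, 0 ≤ l i ∧ l i < r i ∧ r i ≤ n) (hw : ∀ i, 0 < w i)
    (hp : ∀ p : ℝ, ∑ i, (Set.Ioo (l i) (r i)).indicator (fun _ => w i) p ≤ 1) :
    ∑ i, Real.log (r i - l i) ≤ ∑ i, Real.log (w i)⁻¹ := by
  have hint : ∀ i, ∫ p in Set.Ioo (0 : ℝ) n, (Set.Ioo (l i) (r i)).indicator (fun _ => w i) p
      = (r i - l i) * w i := fun i => by
    rw [MeasureTheory.setIntegral_indicator measurableSet_Ioo,
      Set.inter_eq_right.2 (Set.Ioo_subset_Ioo (hI i).1 (hI i).2.2)]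
    simp [(hI i).2.1.le]
  have hintegrable : ∀ i, MeasureTheory.IntegrableOn
      ((Set.Ioo (l i) (r i)).indicator (fun _ => w i)) (Set.Ioo (0 : ℝ) n) := fun i =>
    (MeasureTheory.integrableOn_const (by simp)).indicator measurableSet_Ioo
  have htotal : ∑ i, (r i - l i) * w i ≤ n := by
    calc ∑ i, (r i - l i) * w i
        = ∫ p in Set.Ioo (0 : ℝ) n,
            ∑ i, (Set.Ioo (l i) (r i)).indicator (fun _ => w i) p := by
          rw [MeasureTheory.integral_finsetSum _ fun i _ => hintegrable i]
          exact Finset.sum_congr rfl fun i _ => (hint i).symm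
      _ ≤ ∫ _ in Set.Ioo (0 : ℝ) n, (1 : ℝ) :=
          MeasureTheory.integral_mono
            (MeasureTheory.integrable_finsetSum _ fun i _ => hintegrable i)
            (MeasureTheory.integrableOn_const (by simp)) hp
      _ = n := by simp
  have hterm : ∀ i, Real.log (r i - l i) ≤ Real.log (w i)⁻¹ + ((r i - l i) * w i - 1) := by
    intro i
    have hlen : 0 < r i - l i := sub_pos.2 (hI i).2.1
    have := Real.log_le_sub_one_of_pos (mul_pos hlen (hw i))
    rw [Real.log_mul hlen.ne' (hw i).ne'] at this
    rw [Real.log_inv]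
    linarith
  have hsum := Finset.sum_le_sum fun i (_ : i ∈ Finset.univ) => hterm i
  rw [Finset.sum_add_distrib, Finset.sum_sub_distrib] at hsum
  simp only [Finset.sum_const, Finset.card_univ, Fintype.card_fin, nsmul_eq_mul, mul_one] at hsum
  linarith

lemma mem_contact {n : ℕ} {l r : Fin n → ℝ} {i j : Fin n} :
    j ∈ contact n l r i ↔ j ≤ i ∧ (Set.Ioo (l j) (r j) ∩ Set.Ioo (l i) (r i)).Nonempty := by
  simp [contact]

lemma self_mem_contact {n : ℕ} {l r : Fin n → ℝ} (hlr : ∀ i, l i < r i) (i : Fin n) :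
    i ∈ contact n l r i := by
  simpa [mem_contact] using hlr i

lemma one_le_card_contact {n : ℕ} {l r : Fin n → ℝ} (hlr : ∀ i, l i < r i) (i : Fin n) :
    1 ≤ (contact n l r i).card :=
  Finset.card_pos.2 ⟨i, self_mem_contact hlr i⟩

/-- Total weight of the intervals that have `i` as a contact. -/
noncomputable def incomingWeight (n : ℕ) (l r : Fin n → ℝ) (i : Fin n) : ℝ :=
  ∑ j with i ∈ contact n l r j, contactWeight (contact n l r j).card

/-- The weight of an interval: intervals whose only contact is themselves leave room for the
weights of the later intervals meeting them. -/
noncomputable def intervalWeight (n : ℕ) (l r : Fin n → ℝ) (i : Fin n) : ℝ :=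
  if (contact n l r i).card = 1 then 1 - min (1 / 2) (incomingWeight n l r i)
  else contactWeight (contact n l r i).card

lemma incomingWeight_nonneg (n : ℕ) (l r : Fin n → ℝ) (i : Fin n) :
    0 ≤ incomingWeight n l r i :=
  Finset.sum_nonneg fun _ _ => contactWeight_nonneg _

lemma intervalWeight_pos {n : ℕ} {l r : Fin n → ℝ} (hlr : ∀ i, l i < r i) (i : Fin n) :
    0 < intervalWeight n l r i := by
  unfold intervalWeight
  split_ifs with h
  · linarith [min_le_left (1 / 2) (incomingWeight n l r i)]
  · have := one_le_card_contact hlr i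
    exact contactWeight_pos (by omega)

/-- The weights of pairwise intersecting intervals sum to at most one. -/
lemma sum_intervalWeight_le_one {n : ℕ} {l r : Fin n → ℝ} (P : Finset (Fin n))
    (hP : ∀ i ∈ P, ∀ j ∈ P, (Set.Ioo (l i) (r i) ∩ Set.Ioo (l j) (r j)).Nonempty) :
    ∑ i ∈ P, intervalWeight n l r i ≤ 1 := by
  rcases P.eq_empty_or_nonempty with rfl | hne
  · simp
  set a := P.min' hne with ha
  have haP : a ∈ P := P.min'_mem hne
  have hmem : ∀ q ∈ P, ∀ j ∈ P, j ≤ q → j ∈ contact n l r q := fun q hq j hj hjq =>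
    mem_contact.2 ⟨hjq, hP j hj q hq⟩
  have hlt : ∀ q ∈ P.erase a, a < q := fun q hq =>
    P.min'_lt_of_mem_erase_min' hne hq
  have hrank : ∀ q ∈ P.erase a,
      ((P.erase a).filter (· ≤ q)).card + 1 ≤ (contact n l r q).card := by
    intro q hq
    have hq' := Finset.mem_of_mem_erase hq
    rw [← Finset.card_insert_of_notMem (a := a) (by simp)]
    refine Finset.card_le_card fun j hj => ?_
    rcases Finset.mem_insert.1 hj with rfl | hj
    · exact hmem q hq' _ haP (hlt q hq).le
    · obtain ⟨hj, hjq⟩ := Finset.mem_filter.1 hj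
      exact hmem q hq' j (Finset.mem_of_mem_erase hj) hjq
  have htwo : ∀ q ∈ P.erase a, 2 ≤ (contact n l r q).card := by
    intro q hq
    have h1 : 0 < ((P.erase a).filter (· ≤ q)).card :=
      Finset.card_pos.2 ⟨q, Finset.mem_filter.2 ⟨hq, le_rfl⟩⟩
    have := hrank q hq
    omega
  have hrest : ∑ q ∈ P.erase a, intervalWeight n l r q
      = ∑ q ∈ P.erase a, contactWeight (contact n l r q).card := by
    refine Finset.sum_congr rfl fun q hq => ?_
    have := htwo q hq
    rw [intervalWeight, if_neg (by omega)]
  have hhalf : ∑ q ∈ P.erase a, contactWeight (contact n l r q).card ≤ 1 / 2 :=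
    (sum_contactWeight_le (fun q => (contact n l r q).card) _ hrank).trans
      (sub_le_self _ (by positivity))
  rw [← Finset.add_sum_erase P _ haP, hrest, intervalWeight]
  split_ifs with h1
  · have hin : ∑ q ∈ P.erase a, contactWeight (contact n l r q).card
        ≤ incomingWeight n l r a := by
      refine Finset.sum_le_sum_of_subset_of_nonneg (fun q hq => ?_)
        fun _ _ _ => contactWeight_nonneg _
      exact Finset.mem_filter.2 ⟨Finset.mem_univ _,
        hmem q (Finset.mem_of_mem_erase hq) a haP (hlt q hq).le⟩
    linarith [le_min hhalf hin]
  · have hca : 2 ≤ (contact n l r a).card := by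
      have : 0 < (contact n l r a).card := Finset.card_pos.2 ⟨a, hmem a haP a haP le_rfl⟩
      omega
    have := contactWeight_anti le_rfl hca
    have h4 : contactWeight 2 = 1 / 4 := by norm_num [contactWeight]
    linarith

/-- Each interval is charged by fewer isolated intervals than it has contacts. -/
lemma sum_incomingWeight_le {n : ℕ} {l r : Fin n → ℝ} (hlr : ∀ i, l i < r i) :
    ∑ i with (contact n l r i).card = 1, 2 * incomingWeight n l r i
      ≤ ∑ j with (contact n l r j).card ≠ 1, 1 / ((contact n l r j).card : ℝ) := by
  simp only [incomingWeight, Finset.mul_sum]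
  rw [Finset.sum_comm' (t' := Finset.univ)
    (s' := fun j => {i | (contact n l r i).card = 1 ∧ i ∈ contact n l r j}) (by simp),
    Finset.sum_filter]
  refine Finset.sum_le_sum fun j _ => ?_
  rw [Finset.sum_const, nsmul_eq_mul]
  have hone := one_le_card_contact hlr j
  split_ifs with hj
  · have hsub : (Finset.univ.filter fun i : Fin n =>
        (contact n l r i).card = 1 ∧ i ∈ contact n l r j) ⊆ (contact n l r j).erase j := by
      intro i hi
      obtain ⟨-, h1, h2⟩ := Finset.mem_filter.1 hi
      refine Finset.mem_erase.2 ⟨?_, h2⟩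
      rintro rfl
      exact hj h1
    have hcard := Finset.card_le_card hsub
    rw [Finset.card_erase_of_mem (self_mem_contact hlr j)] at hcard
    have hcard' : ((Finset.univ.filter fun i : Fin n =>
        (contact n l r i).card = 1 ∧ i ∈ contact n l r j).card : ℝ)
          ≤ (contact n l r j).card - 1 := by
      have := (Nat.cast_le (α := ℝ)).2 hcard
      rwa [Nat.cast_sub hone, Nat.cast_one] at this
    refine (mul_le_mul_of_nonneg_right hcard'
      (mul_nonneg two_pos.le (contactWeight_nonneg _))).trans (le_of_eq ?_)
    have h2 : (2 : ℝ) ≤ (contact n l r j).card := by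
      exact_mod_cast (by omega : 2 ≤ (contact n l r j).card)
    have h1 : ((contact n l r j).card : ℝ) - 1 ≠ 0 := by linarith
    unfold contactWeight
    field_simp
  · rw [not_not] at hj
    simp [contactWeight, hj]

lemma sum_log_inv_intervalWeight_le {n : ℕ} {l r : Fin n → ℝ} (hlr : ∀ i, l i < r i) :
    ∑ i, Real.log (intervalWeight n l r i)⁻¹
      ≤ 3 * ∑ i, Real.log ((contact n l r i).card : ℝ) := by
  have hone := one_le_card_contact hlr
  have hisolated : ∑ i with (contact n l r i).card = 1, Real.log (intervalWeight n l r i)⁻¹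
      ≤ ∑ i with (contact n l r i).card = 1, 2 * incomingWeight n l r i := by
    refine Finset.sum_le_sum fun i hi => ?_
    rw [intervalWeight, if_pos (Finset.mem_filter.1 hi).2]
    refine (log_inv_one_sub_le (le_min (by norm_num) (incomingWeight_nonneg n l r i))
      (min_le_left _ _)).trans ?_
    gcongr
    exact min_le_right _ _
  have hother : ∑ i with (contact n l r i).card ≠ 1,
        (Real.log (intervalWeight n l r i)⁻¹ + 1 / ((contact n l r i).card : ℝ))
      ≤ ∑ i with (contact n l r i).card ≠ 1, 3 * Real.log ((contact n l r i).card : ℝ) := by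
    refine Finset.sum_le_sum fun i hi => ?_
    have hi' := (Finset.mem_filter.1 hi).2
    rw [intervalWeight, if_neg hi']
    have := hone i
    exact log_inv_contactWeight_le (by omega)
  have hlast : ∑ i with (contact n l r i).card ≠ 1, 3 * Real.log ((contact n l r i).card : ℝ)
      ≤ ∑ i, 3 * Real.log ((contact n l r i).card : ℝ) :=
    Finset.sum_le_sum_of_subset_of_nonneg (Finset.filter_subset _ _) fun i _ _ =>
      mul_nonneg (by norm_num) (Real.log_natCast_nonneg _)
  have hcharge := sum_incomingWeight_le hlr
  rw [Finset.sum_add_distrib] at hother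
  rw [Finset.mul_sum, ← Finset.sum_filter_add_sum_filter_not Finset.univ
    (fun i => (contact n l r i).card = 1) fun i => Real.log (intervalWeight n l r i)⁻¹]
  linarith

/-- Combinatorially equivalent families have the same intersecting pairs. -/
lemma CombEquiv.inter_nonempty {ι : Type*} {l r l' r' : ι → ℝ} (h : CombEquiv l r l' r')
    (hlr : ∀ i, l i < r i) {i j : ι}
    (hij : (Set.Ioo (l' i) (r' i) ∩ Set.Ioo (l' j) (r' j)).Nonempty) :
    (Set.Ioo (l i) (r i) ∩ Set.Ioo (l j) (r j)).Nonempty := by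
  obtain ⟨p, ⟨hi1, hi2⟩, hj1, hj2⟩ := hij
  have h1 : l j < r i := not_le.1 fun hle => absurd ((h i j).1 hle) (by linarith)
  have h2 : l i < r j := not_le.1 fun hle => absurd ((h j i).1 hle) (by linarith)
  rw [Set.Ioo_inter_Ioo, Set.nonempty_Ioo]
  exact max_lt (lt_min (hlr i) h2) (lt_min h1 (hlr j))

lemma sum_logb_length_le_piAmbiguity {n : ℕ} {l r l' r' : Fin n → ℝ} (hlr : ∀ i, l i < r i)
    (hI : ∀ i, 0 ≤ l' i ∧ l' i < r' i ∧ r' i ≤ n) (h : CombEquiv l r l' r') :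
    ∑ i, Real.logb 2 (r' i - l' i) ≤ 3 * piAmbiguity n l r := by
  have hlog : ∑ i, Real.log (r' i - l' i) ≤ 3 * ∑ i, Real.log ((contact n l r i).card : ℝ) := by
    refine (sum_log_length_le n l' r' _ hI (intervalWeight_pos hlr) fun p => ?_).trans
      (sum_log_inv_intervalWeight_le hlr)
    simp only [Set.indicator_apply]
    rw [← Finset.sum_filter]
    refine sum_intervalWeight_le_one _ fun i hi j hj => h.inter_nonempty hlr ⟨p, ?_, ?_⟩
    · exact (Finset.mem_filter.1 hi).2
    · exact (Finset.mem_filter.1 hj).2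
  simp only [piAmbiguity, Real.logb, ← Finset.sum_div]
  rw [← mul_div_assoc]
  exact div_le_div_of_nonneg_right hlog (Real.log_nonneg one_le_two)

theorem stmt3 (n : ℕ) (hn : 1 ≤ n) (l r : Fin n → ℝ) (hlr : ∀ i, l i < r i)
    (π : Equiv.Perm (Fin n))
    (hcc : ContainmentCompatible n (l ∘ π) (r ∘ π)) :
    (n : ℝ) * intervalEntropy n l r ≤ 3 * piAmbiguity n (l ∘ π) (r ∘ π) := by
  have hn0 : (n : ℝ) ≠ 0 := Nat.cast_ne_zero.2 (by omega)
  rw [intervalEntropy, mul_div_cancel₀ _ hn0]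
  refine Real.sSup_le ?_ (mul_nonneg (by norm_num) (Finset.sum_nonneg fun i _ =>
    div_nonneg (Real.log_natCast_nonneg _) (Real.log_nonneg one_le_two)))
  rintro x ⟨l', r', hI, h, rfl⟩
  rw [← Equiv.sum_comp π]
  exact sum_logb_length_le_piAmbiguity (l' := l' ∘ π) (r' := r' ∘ π) (fun i => hlr (π i))
    (fun i => hI (π i)) fun i j => h (π i) (π j)
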